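/- arXiv:math/0501474 — 3 statements merged into one kernel-verified Lean document; each statement's English description precedes it below -/
import Mathlib

section
/- Let G be a profinite group. The functor from abelian groups to abelian groups sending A to C(G, A), and sending a homomorphism φ : A → B to postcomposition f ↦ φ ∘ f, is additive and exact: for every short exact sequence 0 → A → B → C → 0 of abelian groups, the induced sequence 0 → C(G, A) → C(G, B) → C(G, C) → 0 is a short exact sequence of abelian groups. -/
/-- A group with the discrete topology is a topological additive group. -/
instance (priority := 100) DiscreteTopology.toTopologicalAddGroup
    (A : Type*) [AddGroup A] [TopologicalSpace A] [DiscreteTopology A] :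
    IsTopologicalAddGroup A :=
  { toContinuousAdd := inferInstance, toContinuousNeg := inferInstance }

/-- Postcomposition with an additive homomorphism `φ : A →+ B` between discrete abelian
groups, `f ↦ φ ∘ f`, as an additive homomorphism `C(G, A) →+ C(G, B)` on the abelian groups
of continuous maps.  (That this is an additive homomorphism expresses the additivity of the
functor `A ↦ C(G, A)`.) -/
def compHom {G A B : Type} [TopologicalSpace G]
    [AddCommGroup A] [TopologicalSpace A] [DiscreteTopology A]
    [AddCommGroup B] [TopologicalSpace B] [DiscreteTopology B]
    (φ : A →+ B) : C(G, A) →+ C(G, B) where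
  toFun u := (⟨φ, continuous_of_discreteTopology⟩ : C(A, B)).comp u
  map_zero' := by ext x; simp
  map_add' u v := by ext x; simp

/-- Let `G` be a profinite group.  The functor `A ↦ C(G, A)` (continuous maps
from `G` to the discrete abelian group `A`), sending `φ : A →+ B` to postcomposition
`f ↦ φ ∘ f` (this is the additive homomorphism `compHom φ`), is exact: for every short exact
sequence `0 → A → B → C' → 0` of abelian groups, the induced sequence
`0 → C(G, A) → C(G, B) → C(G, C') → 0` is a short exact sequence of abelian groups. -/
theorem compHom_exact
    (G : Type) [Group G] [TopologicalSpace G] [IsTopologicalGroup G]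
    [CompactSpace G] [T2Space G] [TotallyDisconnectedSpace G]
    {A B C' : Type}
    [AddCommGroup A] [TopologicalSpace A] [DiscreteTopology A]
    [AddCommGroup B] [TopologicalSpace B] [DiscreteTopology B]
    [AddCommGroup C'] [TopologicalSpace C'] [DiscreteTopology C']
    (f : A →+ B) (g : B →+ C')
    (hf : Function.Injective f) (hg : Function.Surjective g)
    (hfg : Function.Exact ⇑f ⇑g) :
    Function.Injective ⇑(compHom (G := G) f) ∧
    Function.Surjective ⇑(compHom (G := G) g) ∧
    Function.Exact ⇑(compHom (G := G) f) ⇑(compHom (G := G) g) := by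
  refine ⟨?_, ?_, ?_⟩
  · intro u v h
    ext x
    exact hf (DFunLike.congr_fun h x)
  · intro w
    refine ⟨(⟨Function.surjInv hg, continuous_of_discreteTopology⟩ : C(C', B)).comp w, ?_⟩
    ext x
    exact Function.surjInv_eq hg (w x)
  · intro u
    constructor
    · intro h
      refine ⟨(⟨Function.invFun f, continuous_of_discreteTopology⟩ : C(B, A)).comp u, ?_⟩
      ext x
      exact Function.invFun_eq ((hfg (u x)).1 (DFunLike.congr_fun h x))
    · rintro ⟨v, rfl⟩
      ext x
      exact hfg.apply_apply_eq_zero (v x)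
end

section
/- Let G be a profinite group. If {A_i}_{i ≥ 0} is a tower of abelian groups satisfying the Mittag-Leffler condition, then the tower {C(G, A_i)}_{i ≥ 0} of abelian groups of continuous maps (with each A_i discrete, and transition maps given by postcomposition) also satisfies the Mittag-Leffler condition. -/
/-- The image of postcomposition with `φ` consists of the maps with values in the image of `φ`:
a set-theoretic section of `φ` over its image is automatically continuous. -/
theorem range_compHom {G A B : Type} [TopologicalSpace G]
    [AddCommGroup A] [TopologicalSpace A] [DiscreteTopology A]
    [AddCommGroup B] [TopologicalSpace B] [DiscreteTopology B]
    (φ : A →+ B) :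
    Set.range ⇑(compHom (G := G) φ) = {f : C(G, B) | ∀ x, f x ∈ Set.range ⇑φ} := by
  ext f
  constructor
  · rintro ⟨u, rfl⟩ x
    exact ⟨u x, rfl⟩
  · intro hf
    refine ⟨(⟨Function.invFun φ, continuous_of_discreteTopology⟩ : C(B, A)).comp f, ?_⟩
    ext x
    exact Function.invFun_eq (hf x)

/-- Let `G` be a profinite group.  If `{A i}` is a tower of abelian groups
(with compatible transition maps `t i j : A j →+ A i` for `i ≤ j`) satisfying the
Mittag-Leffler condition, then the tower `{C(G, A i)}` of abelian groups of continuous maps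
(each `A i` discrete, transition maps given by postcomposition) also satisfies the
Mittag-Leffler condition. -/
theorem mittagLeffler_continuousMaps
    (G : Type) [Group G] [TopologicalSpace G] [IsTopologicalGroup G]
    [CompactSpace G] [T2Space G] [TotallyDisconnectedSpace G]
    (A : ℕ → Type) [∀ i, AddCommGroup (A i)]
    [∀ i, TopologicalSpace (A i)] [∀ i, DiscreteTopology (A i)]
    (t : ∀ i j : ℕ, i ≤ j → (A j →+ A i))
    (ht_id : ∀ i : ℕ, t i i le_rfl = AddMonoidHom.id (A i))
    (ht_comp : ∀ (i j k : ℕ) (h₁ : i ≤ j) (h₂ : j ≤ k),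
      (t i j h₁).comp (t j k h₂) = t i k (h₁.trans h₂))
    (hML : ∀ i : ℕ, ∃ j : ℕ, ∃ h : i ≤ j, ∀ (k : ℕ) (h' : j ≤ k),
      Set.range ⇑(t i k (h.trans h')) = Set.range ⇑(t i j h)) :
    ∀ i : ℕ, ∃ j : ℕ, ∃ h : i ≤ j, ∀ (k : ℕ) (h' : j ≤ k),
      Set.range ⇑(compHom (G := G) (t i k (h.trans h'))) =
        Set.range ⇑(compHom (G := G) (t i j h)) := by
  intro i
  obtain ⟨j, h, hj⟩ := hML i
  refine ⟨j, h, fun k h' => ?_⟩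
  rw [range_compHom, range_compHom, hj k h']
end

section
/- Let G be an infinite profinite group, let U be an open subgroup of G, and let A be a set with the discrete topology having at least two elements. Then there exist a continuous map f : G → A and an element u ∈ U such that the continuous map g ↦ f(gu) is not equal to f. In particular, the right-translation action of G on C(G, A), given by (g' · f)(g) = f(gg'), does not restrict to the trivial action of U, so when U is normal this action does not factor through the finite quotient G/U. -/
/-- Let `G` be an infinite profinite group, `U` an open subgroup of `G`, and
`A` a discrete space with at least two elements.  Then there exist a continuous map
`f : G → A` and an element `u ∈ U` such that the (continuous) right translate `g ↦ f (g * u)`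
is not equal to `f`.  In particular the right-translation action `(g' • f) g = f (g * g')` of
`G` on `C(G, A)` does not restrict to the trivial action of `U`, so for `U` normal it does
not factor through the finite quotient `G ⧸ U`. -/
theorem exists_translate_ne_of_isOpen_subgroup
    (G : Type) [Group G] [TopologicalSpace G] [IsTopologicalGroup G]
    [CompactSpace G] [T2Space G] [TotallyDisconnectedSpace G] [Infinite G]
    (U : Subgroup G) (hU : IsOpen (U : Set G))
    (A : Type) [TopologicalSpace A] [DiscreteTopology A] [Nontrivial A] :
    ∃ f : C(G, A), ∃ u ∈ U, (fun g => f (g * u)) ≠ ⇑f := by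
  have hne : U ≠ ⊥ := by
    rintro rfl
    have h1 : IsOpen ({1} : Set G) := by simpa using hU
    have : DiscreteTopology G := discreteTopology_of_isOpen_singleton_one h1
    have : Finite G := finite_of_compact_of_discrete
    exact not_finite G
  obtain ⟨u, hu, hu1⟩ := U.bot_or_exists_ne_one.resolve_left hne
  obtain ⟨V, hV, huV, h1V⟩ := exists_isClopen_of_totally_separated hu1
  obtain ⟨a, b, hab⟩ := exists_pair_ne A
  classical
  refine ⟨⟨fun g => if g ∈ V then a else b, ?_⟩, u, hu, fun h => ?_⟩
  · refine continuous_const.if (fun x hx => ?_) continuous_const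
    have hx' : x ∈ frontier V := hx
    rw [hV.frontier_eq] at hx'
    exact hx'.elim
  · have h2 := congrFun h 1
    have h3 : (1 : G) ∉ V := h1V
    simp [huV, h3] at h2
    exact hab h2
end
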